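/- arXiv:2301.13632 — 3 statements merged into one kernel-verified Lean document; each statement's English description precedes it below -/
import Mathlib

section
/- For every odd integer m ≥ 3, the graph J_m is 2-tough: for every cut-set S of J_m, the number of connected components of the subgraph of J_m induced on the complement of S is at most |S|/2, i.e., 2·k(J_m − S) ≤ |S|. -/
/-- Vertex set of the graph `J m`: `A = Fin m` (the `a_i`), `B = Fin m` (the `b_i`),
`C = Fin (m-1)` (the `c_i`), all 0-indexed. -/
abbrev JVert (m : ℕ) := Fin m ⊕ Fin m ⊕ Fin (m - 1)

/-- The vertex `a_{i+1}` (0-indexed `i`). -/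
def Ja {m : ℕ} (i : Fin m) : JVert m := Sum.inl i
/-- The vertex `b_{i+1}` (0-indexed `i`). -/
def Jb {m : ℕ} (i : Fin m) : JVert m := Sum.inr (Sum.inl i)
/-- The vertex `c_{i+1}` (0-indexed `i`). -/
def Jc {m : ℕ} (i : Fin (m - 1)) : JVert m := Sum.inr (Sum.inr i)

/-- The graph `J m`: two `m`-cycles on `A` and on `B`; each `c_i` joined to
`a_i, a_{i+1}, b_i, b_{i+1}`; and the two extra edges `a_1 b_1` and `a_m b_m`. -/
def JGraph (m : ℕ) : SimpleGraph (JVert m) :=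
  SimpleGraph.fromRel (fun x y =>
    match x, y with
    | Sum.inl i, Sum.inl j => (j : ℕ) = ((i : ℕ) + 1) % m
    | Sum.inr (Sum.inl i), Sum.inr (Sum.inl j) => (j : ℕ) = ((i : ℕ) + 1) % m
    | Sum.inr (Sum.inr i), Sum.inl j => (j : ℕ) = (i : ℕ) ∨ (j : ℕ) = (i : ℕ) + 1
    | Sum.inr (Sum.inr i), Sum.inr (Sum.inl j) => (j : ℕ) = (i : ℕ) ∨ (j : ℕ) = (i : ℕ) + 1
    | Sum.inl i, Sum.inr (Sum.inl j) =>
        ((i : ℕ) = 0 ∧ (j : ℕ) = 0) ∨ ((i : ℕ) = m - 1 ∧ (j : ℕ) = m - 1)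
    | _, _ => False)

noncomputable instance {m : ℕ} : DecidableRel (JGraph m).Adj := Classical.decRel _

/-- `S` is a cut-set of `G`: the induced subgraph on the complement of `S`
has at least two vertices and is not connected. -/
def IsCutset {V : Type*} (G : SimpleGraph V) (S : Set V) : Prop :=
  Sᶜ.Nontrivial ∧ ¬ (G.induce Sᶜ).Connected

/-- `s` is an independent set in `G`. -/
def IsIndepSet {V : Type*} (G : SimpleGraph V) (s : Set V) : Prop :=
  s.Pairwise fun u v => ¬ G.Adj u v

open Classical in
/-- If every adjacency-closed property of `Sᶜ` that holds on `R \ S` holds on all of `Sᶜ`, then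
`G - S` has at most `|R|` components. -/
theorem card_components_le {V : Type*} (G : SimpleGraph V) (S : Set V) (R : Finset V)
    (h : ∀ X : V → Prop, (∀ u v, u ∉ S → v ∉ S → G.Adj u v → X u → X v) →
      (∀ r ∈ R, r ∉ S → X r) → ∀ v, v ∉ S → X v) :
    Nat.card (G.induce Sᶜ).ConnectedComponent ≤ R.card := by
  have key := h (fun v => ∃ (hv : v ∉ S) (r : {r : V // r ∈ R}) (hr : r.1 ∉ S),
      (G.induce Sᶜ).connectedComponentMk ⟨v, hv⟩ =
        (G.induce Sᶜ).connectedComponentMk ⟨r.1, hr⟩)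
    (by
      rintro u v hu hv huv ⟨_, r, hr, e⟩
      refine ⟨hv, r, hr, ?_⟩
      rw [← e, SimpleGraph.ConnectedComponent.eq]
      exact (SimpleGraph.Adj.reachable (by simpa using huv.symm)))
    (fun r hr hrS => ⟨hrS, ⟨r, hr⟩, hrS, rfl⟩)
  have key' : ∀ C : (G.induce Sᶜ).ConnectedComponent, ∃ (r : {r : V // r ∈ R}) (hr : r.1 ∉ S),
      C = (G.induce Sᶜ).connectedComponentMk ⟨r.1, hr⟩ := by
    intro C
    induction C using SimpleGraph.ConnectedComponent.ind with
    | h v =>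
      obtain ⟨_, r, hr, e⟩ := key v.1 v.2
      exact ⟨r, hr, e⟩
  choose f hf hf' using key'
  have hinj : Function.Injective f := by
    intro C D e
    rw [hf' C, hf' D]
    simp only [e]
  simpa using Nat.card_le_card_of_injective f hinj

/-- A cut-set leaves at least two components. -/
theorem IsCutset.two_le_card_components {V : Type*} [Finite V] {G : SimpleGraph V} {S : Set V}
    (hS : IsCutset G S) : 2 ≤ Nat.card (G.induce Sᶜ).ConnectedComponent := by
  by_contra hlt
  obtain ⟨v, hv⟩ := hS.1.nonempty
  have hsub : Subsingleton (G.induce Sᶜ).ConnectedComponent :=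
    Finite.card_le_one_iff_subsingleton.1 (by omega)
  refine hS.2 ((SimpleGraph.connected_iff _).2 ⟨fun x y => ?_, ⟨⟨v, hv⟩⟩⟩)
  exact SimpleGraph.ConnectedComponent.eq.1 (Subsingleton.elim _ _)

namespace JLadder

/-! In this namespace `a i`, `b i`, `c i` say that the vertices `a_i`, `b_i`, `c_i` are deleted
(indices start at `0` and `n = m - 1`), and `A i`, `B i`, `C i` that they satisfy a given property.
The vertex `c_n` does not exist; it counts as not deleted, in place of the edge `a_n b_n`. -/

/-- The property `(A, B, C)` of vertices is constant on the components of the undeleted graph. -/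
structure Closed (n : ℕ) (a b c A B C : ℕ → Prop) : Prop where
  aa : ∀ i < n, ¬a i → ¬a (i + 1) → (A i ↔ A (i + 1))
  bb : ∀ i < n, ¬b i → ¬b (i + 1) → (B i ↔ B (i + 1))
  ca : ∀ i < n, ¬c i → ¬a i → (C i ↔ A i)
  ca' : ∀ i < n, ¬c i → ¬a (i + 1) → (C i ↔ A (i + 1))
  cb : ∀ i < n, ¬c i → ¬b i → (C i ↔ B i)
  cb' : ∀ i < n, ¬c i → ¬b (i + 1) → (C i ↔ B (i + 1))
  first : ¬a 0 → ¬b 0 → (A 0 ↔ B 0)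
  last : ¬a n → ¬b n → (A n ↔ B n)
  wrapA : ¬a 0 → ¬a n → (A 0 ↔ A n)
  wrapB : ¬b 0 → ¬b n → (B 0 ↔ B n)

/-- `a_{i+1}` is chosen as the representative of a component. -/
def NewA (a b c : ℕ → Prop) (i : ℕ) : Prop :=
  a i ∧ c i ∧ ¬a (i + 1) ∧ ¬(¬b (i + 1) ∧ ¬c (i + 1))

/-- `b_{i+1}` is chosen as the representative of a component. -/
def NewB (a b c : ℕ → Prop) (i : ℕ) : Prop :=
  b i ∧ c i ∧ ¬b (i + 1) ∧ ¬(¬a (i + 1) ∧ ¬c (i + 1) ∧ ¬a i)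

/-- `c_i` is chosen as the representative of a component. -/
def NewC (a b c : ℕ → Prop) (i : ℕ) : Prop := a i ∧ b i ∧ ¬c i

/-- The deleted vertices in position `i` separate the left from the right. -/
def Sep (a b c : ℕ → Prop) (i : ℕ) : Prop :=
  (a i ∧ b i) ∨ (a i ∧ c i ∧ b (i + 1)) ∨ (b i ∧ c i ∧ a (i + 1))

section Cover

variable {n : ℕ} {a b c A B C : ℕ → Prop}

theorem Closed.swap (h : Closed n a b c A B C) : Closed n b a c B A C :=
  ⟨h.bb, h.aa, h.cb, h.cb', h.ca, h.ca', fun x y => (h.first y x).symm,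
    fun x y => (h.last y x).symm, h.wrapB, h.wrapA⟩

theorem Closed.rung (h : Closed n a b c A B C) {i : ℕ} (hi : i ≤ n) (hc : ¬c i)
    (ha : ¬a i) (hb : ¬b i) : A i ↔ B i := by
  rcases hi.eq_or_lt with rfl | hi
  · exact h.last ha hb
  · rw [← h.ca i hi hc ha, h.cb i hi hc hb]

/-- All undeleted vertices among `a_i`, `b_i` have the property. -/
def Col (a b A B : ℕ → Prop) (i : ℕ) : Prop := (¬a i → A i) ∧ (¬b i → B i)

theorem Closed.col_succ (h : Closed n a b c A B C) {i : ℕ} (hi : i < n)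
    (hA : NewA a b c i → A (i + 1)) (hB : NewB a b c i → B (i + 1)) (hC : NewC a b c i → C i)
    (hcol : Col a b A B i) : Col a b A B (i + 1) := by
  have h1 := h.aa i hi
  have h2 := h.bb i hi
  have h3 := h.ca i hi
  have h4 := h.ca' i hi
  have h5 := h.cb i hi
  have h6 := h.cb' i hi
  have h7 := h.rung (i := i + 1) hi
  unfold NewA at hA
  unfold NewB at hB
  unfold NewC at hC
  unfold Col at *
  grind

theorem Closed.col_of_le (h : Closed n a b c A B C)
    (hA : ∀ i < n, NewA a b c i → A (i + 1)) (hB : ∀ i < n, NewB a b c i → B (i + 1))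
    (hC : ∀ i < n, NewC a b c i → C i) {i j : ℕ} (hij : i ≤ j) (hj : j ≤ n)
    (hcol : Col a b A B i) : Col a b A B j := by
  induction j, hij using Nat.le_induction with
  | base => exact hcol
  | succ j _ ih => exact h.col_succ hj (hA j hj) (hB j hj) (hC j hj) (ih (by omega))

/-- Once the first column has the property, so does everything. -/
theorem Closed.cover (h : Closed n a b c A B C)
    (hA : ∀ i < n, NewA a b c i → A (i + 1)) (hB : ∀ i < n, NewB a b c i → B (i + 1))
    (hC : ∀ i < n, NewC a b c i → C i) (hcol : Col a b A B 0) :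
    (∀ i ≤ n, Col a b A B i) ∧ ∀ i < n, ¬c i → C i := by
  have hall : ∀ i ≤ n, Col a b A B i := fun i hi => h.col_of_le hA hB hC (Nat.zero_le i) hi hcol
  refine ⟨hall, fun i hi hc => ?_⟩
  have h1 := hall i hi.le
  have h3 := h.ca i hi hc
  have h5 := h.cb i hi hc
  have h6 := hC i hi
  unfold NewC at h6
  unfold Col at h1
  tauto

theorem Closed.col_zero (h : Closed n a b c A B C) (hA : ¬a 0 → A 0)
    (hB : a 0 → ¬b 0 → B 0) : Col a b A B 0 := by
  have := h.first
  unfold Col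
  tauto

/-- With a separator and an undeleted wrap-around edge, the first column has the property. -/
theorem Closed.col_zero_of_sep (h : Closed n a b c A B C)
    (hA : ∀ i < n, NewA a b c i → A (i + 1)) (hB : ∀ i < n, NewB a b c i → B (i + 1))
    (hC : ∀ i < n, NewC a b c i → C i) (hcn : ¬c n) (hsep : ∃ i ≤ n, Sep a b c i)
    (hwrap : (¬a 0 ∧ ¬a n) ∨ (¬b 0 ∧ ¬b n)) : Col a b A B 0 := by
  have hn : Col a b A B n := by
    obtain ⟨i, hi, hs | hs | hs⟩ := hsep
    · exact h.col_of_le hA hB hC hi le_rfl ⟨fun x => absurd hs.1 x, fun x => absurd hs.2 x⟩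
    all_goals
      have hlt : i < n := lt_of_le_of_ne hi (by rintro rfl; exact hcn hs.2.1)
      refine h.col_of_le hA hB hC (i := i + 1) hlt le_rfl ?_
      have h1 := hA i hlt
      have h2 := hB i hlt
      unfold NewA at h1
      unfold NewB at h2
      unfold Col
      tauto
  have h1 := h.first
  have h2 := h.wrapA
  have h3 := h.wrapB
  unfold Col at *
  tauto

/-- Deleting only `a_j`, `c_j`, `c_{j+1}` leaves the graph connected. -/
theorem Closed.cover_of_three (h : Closed n a b c A B C) {j : ℕ} (hj : j + 1 < n)
    (ha : ∀ i, a i ↔ i = j) (hb : ∀ i, ¬b i) (hc : ∀ i, c i ↔ i = j ∨ i = j + 1)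
    (hcol : Col a b A B 0) : (∀ i ≤ n, Col a b A B i) ∧ ∀ i < n, ¬c i → C i := by
  have hB : ∀ i ≤ n, B i := by
    intro i
    induction i with
    | zero => exact fun _ => hcol.2 (hb 0)
    | succ i ih => exact fun hi => (h.bb i hi (hb i) (hb _)).1 (ih (by omega))
  have hA : ∀ i ≤ n, i ≠ j → i ≠ j + 1 → A i := fun i hi h1 h2 =>
    (h.rung hi (by rw [hc]; omega) (by rw [ha]; omega) (hb i)).2 (hB i hi)
  have hA' : A (j + 1) := (h.aa (j + 1) hj (by rw [ha]; omega) (by rw [ha]; omega)).2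
    (hA (j + 2) hj (by omega) (by omega))
  refine ⟨fun i hi => ⟨fun hai => ?_, fun _ => hB i hi⟩,
    fun i hi hci => (h.cb i hi hci (hb i)).2 (hB i hi.le)⟩
  rw [ha] at hai
  by_cases h1 : i = j + 1
  · exact h1 ▸ hA'
  · exact hA i hi hai h1

end Cover

section Count

open Classical

/-- The number of representatives chosen in position `i`. -/
noncomputable def newCount (a b c : ℕ → Prop) (i : ℕ) : ℕ :=
  (if NewA a b c i then 1 else 0) + (if NewB a b c i then 1 else 0) +
    (if NewC a b c i then 1 else 0)

/-- The number of deleted vertices in position `i`. -/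
noncomputable def delCount (a b c : ℕ → Prop) (i : ℕ) : ℕ :=
  (if a i then 1 else 0) + (if b i then 1 else 0) + (if c i then 1 else 0)

/-- The debt that may be carried into position `i`. -/
noncomputable def debt (a b c : ℕ → Prop) (i : ℕ) : ℕ :=
  if ¬a i ∧ ¬b i ∧ c i then 1 else 0

variable {a b c : ℕ → Prop}

theorem two_mul_newCount_le (i : ℕ) :
    2 * newCount a b c i + debt a b c i ≤ delCount a b c i + debt a b c (i + 1) := by
  unfold newCount delCount debt NewA NewB NewC
  by_cases h1 : a i <;> by_cases h2 : b i <;> by_cases h3 : c i <;>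
    by_cases h4 : a (i + 1) <;> by_cases h5 : b (i + 1) <;> by_cases h6 : c (i + 1) <;>
    simp [*]

theorem two_mul_newCount_lt (i : ℕ) (h : a i ↔ ¬b i)
    (h' : ¬((a (i + 1) ↔ b i) ∧ (b (i + 1) ↔ a i))) :
    2 * newCount a b c i + 1 ≤ delCount a b c i + debt a b c (i + 1) := by
  unfold newCount delCount debt NewA NewB NewC
  by_cases h1 : a i <;> by_cases h2 : b i <;> by_cases h3 : c i <;>
    by_cases h4 : a (i + 1) <;> by_cases h5 : b (i + 1) <;> by_cases h6 : c (i + 1) <;>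
    simp_all

theorem three_mul_newCount_le (i : ℕ) (hi : ¬Sep a b c i) (hi' : ¬Sep a b c (i + 1)) :
    3 * newCount a b c i + debt a b c i ≤ delCount a b c i + debt a b c (i + 1) := by
  unfold Sep at hi hi'
  unfold newCount delCount debt NewA NewB NewC
  by_cases h1 : a i <;> by_cases h2 : b i <;> by_cases h3 : c i <;>
    by_cases h4 : a (i + 1) <;> by_cases h5 : b (i + 1) <;> by_cases h6 : c (i + 1) <;>
    simp_all

theorem del_of_newCount_ne_zero {i : ℕ} (hi : ¬Sep a b c i) (hpos : newCount a b c i ≠ 0) :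
    (a i ∨ b i) ∧ c i ∧ c (i + 1) := by
  unfold Sep at hi
  unfold newCount NewA NewB NewC at hpos
  by_cases h1 : a i <;> by_cases h2 : b i <;> by_cases h3 : c i <;> simp_all

theorem two_mul_sum_newCount_le (n : ℕ) :
    2 * ∑ i ∈ Finset.range n, newCount a b c i ≤
      ∑ i ∈ Finset.range n, delCount a b c i + debt a b c n := by
  induction n with
  | zero => simp
  | succ n ih =>
    have := two_mul_newCount_le (a := a) (b := b) (c := c) n
    rw [Finset.sum_range_succ, Finset.sum_range_succ]
    omega

/-- If exactly one of `a_0`, `b_0` is deleted, the count is strict unless the deleted vertices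
alternate between the two sides. -/
theorem two_mul_sum_newCount_lt_or (h0 : a 0 ↔ ¬b 0) (n : ℕ) :
    2 * ∑ i ∈ Finset.range n, newCount a b c i + 1 ≤
        ∑ i ∈ Finset.range n, delCount a b c i + debt a b c n ∨
      ((a n ↔ ¬b n) ∧ (a n ↔ if Even n then a 0 else b 0)) := by
  induction n with
  | zero => simp [h0]
  | succ n ih =>
    rw [Finset.sum_range_succ, Finset.sum_range_succ]
    rcases ih with ih | ⟨ih1, ih2⟩
    · have := two_mul_newCount_le (a := a) (b := b) (c := c) n
      left
      omega
    · by_cases h : (a (n + 1) ↔ b n) ∧ (b (n + 1) ↔ a n)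
      · right
        by_cases hn : Even n
        · rw [if_pos hn] at ih2
          rw [if_neg (by simpa [Nat.even_add_one] using hn)]
          tauto
        · rw [if_neg hn] at ih2
          rw [if_pos (Nat.even_add_one.2 hn)]
          tauto
      · left
        have h1 := two_mul_newCount_lt (c := c) n ih1 h
        have h2 := two_mul_sum_newCount_le (a := a) (b := b) (c := c) n
        have h3 : debt a b c n = 0 := by
          unfold debt
          rw [if_neg]
          tauto
        omega

theorem three_mul_sum_newCount_le (n : ℕ) (hn : ∀ i ≤ n, ¬Sep a b c i) :
    3 * ∑ i ∈ Finset.range n, newCount a b c i ≤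
      ∑ i ∈ Finset.range n, delCount a b c i + debt a b c n := by
  induction n with
  | zero => simp
  | succ n ih =>
    have := three_mul_newCount_le n (hn n (by omega)) (hn (n + 1) le_rfl)
    have := ih fun i hi => hn i (by omega)
    rw [Finset.sum_range_succ, Finset.sum_range_succ]
    omega

end Count

section Graph

open Classical

variable {n : ℕ} (S : Finset (JVert (n + 1)))

/-- The vertex `a_i` is deleted. -/
def delA (i : ℕ) : Prop := ∃ h : i < n + 1, (Ja ⟨i, h⟩ : JVert (n + 1)) ∈ S
/-- The vertex `b_i` is deleted. -/
def delB (i : ℕ) : Prop := ∃ h : i < n + 1, (Jb ⟨i, h⟩ : JVert (n + 1)) ∈ S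
/-- The vertex `c_i` is deleted. -/
def delC (i : ℕ) : Prop := ∃ h : i < n, (Jc ⟨i, h⟩ : JVert (n + 1)) ∈ S

theorem delA_iff (i : Fin (n + 1)) : delA S i ↔ Ja i ∈ S := ⟨fun ⟨_, h⟩ => h, fun h => ⟨i.2, h⟩⟩
theorem delB_iff (i : Fin (n + 1)) : delB S i ↔ Jb i ∈ S := ⟨fun ⟨_, h⟩ => h, fun h => ⟨i.2, h⟩⟩
theorem delC_iff (i : Fin n) : delC S i ↔ (Jc i : JVert (n + 1)) ∈ S :=
  ⟨fun ⟨_, h⟩ => h, fun h => ⟨i.2, h⟩⟩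

/-- The chosen representatives of the components of `J - S`, except for that of `a_0`, `b_0`. -/
noncomputable def reps : Finset (JVert (n + 1)) :=
  Finset.univ.filter (Sum.elim (fun i => i.1 ≠ 0 ∧ NewA (delA S) (delB S) (delC S) (i.1 - 1))
    (Sum.elim (fun i => i.1 ≠ 0 ∧ NewB (delA S) (delB S) (delC S) (i.1 - 1))
      fun i => NewC (delA S) (delB S) (delC S) i.1))

/-- The representative of the component of `a_0` or `b_0`. -/
noncomputable def firstRep : JVert (n + 1) := if delA S 0 then Jb 0 else Ja 0

theorem card_reps :
    (reps S).card = ∑ i ∈ Finset.range n, newCount (delA S) (delB S) (delC S) i := by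
  rw [reps, Finset.card_filter, Fintype.sum_sum_type, Fintype.sum_sum_type, Fin.sum_univ_succ,
    Fin.sum_univ_succ]
  simp only [newCount, Finset.sum_add_distrib, Finset.sum_range]
  simp [add_assoc]

theorem card_eq_sum_delCount : S.card =
    ∑ i ∈ Finset.range n, delCount (delA S) (delB S) (delC S) i +
      ((if delA S n then 1 else 0) + (if delB S n then 1 else 0)) := by
  have h : S.card = ∑ v : JVert (n + 1), if v ∈ S then 1 else 0 := by simp
  rw [h, Fintype.sum_sum_type, Fintype.sum_sum_type, Fin.sum_univ_castSucc,
    Fin.sum_univ_castSucc]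
  simp only [delCount, Finset.sum_add_distrib, Finset.sum_range]
  have hA : ∀ i : Fin (n + 1), Sum.inl i ∈ S ↔ delA S i := fun i => (delA_iff S i).symm
  have hB : ∀ i : Fin (n + 1), Sum.inr (Sum.inl i) ∈ S ↔ delB S i := fun i => (delB_iff S i).symm
  have hC : (∑ x : Fin (n + 1 - 1), if Sum.inr (Sum.inr x) ∈ S then 1 else 0) =
      ∑ x : Fin n, if delC S x then 1 else 0 :=
    Finset.sum_congr rfl fun i _ => if_congr (delC_iff S i).symm rfl rfl
  simp only [hA, hB, Fin.val_castSucc, Fin.val_last, hC]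
  ring

/-- The vertices `a_i` satisfy `X`. -/
def propA (X : JVert (n + 1) → Prop) (i : ℕ) : Prop := ∀ h : i < n + 1, X (Ja ⟨i, h⟩)
/-- The vertices `b_i` satisfy `X`. -/
def propB (X : JVert (n + 1) → Prop) (i : ℕ) : Prop := ∀ h : i < n + 1, X (Jb ⟨i, h⟩)
/-- The vertices `c_i` satisfy `X`. -/
def propC (X : JVert (n + 1) → Prop) (i : ℕ) : Prop := ∀ h : i < n, X (Jc ⟨i, h⟩)

variable {S}

theorem closed_of_adj (hn : 0 < n) {X : JVert (n + 1) → Prop}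
    (hX : ∀ u v, u ∉ S → v ∉ S → (JGraph (n + 1)).Adj u v → X u → X v) :
    Closed n (delA S) (delB S) (delC S) (propA X) (propB X) (propC X) := by
  have hX' : ∀ u v, (JGraph (n + 1)).Adj u v → u ∉ S → v ∉ S → (X u ↔ X v) :=
    fun u v h hu hv => ⟨hX u v hu hv h, hX v u hv hu h.symm⟩
  constructor
  · intro i hi h1 h2
    have h3 : i < n + 1 := by omega
    have h4 : i + 1 < n + 1 := by omega
    simpa [delA, propA, h3, h4, hi] using hX' (Ja ⟨i, h3⟩) (Ja ⟨i + 1, h4⟩)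
      (by simp [JGraph, Ja, Nat.mod_eq_of_lt h4]) (by simpa [delA, h3] using h1)
      (by simpa [delA, hi] using h2)
  · intro i hi h1 h2
    have h3 : i < n + 1 := by omega
    have h4 : i + 1 < n + 1 := by omega
    simpa [delB, propB, h3, h4, hi] using hX' (Jb ⟨i, h3⟩) (Jb ⟨i + 1, h4⟩)
      (by simp [JGraph, Jb, Nat.mod_eq_of_lt h4]) (by simpa [delB, h3] using h1)
      (by simpa [delB, hi] using h2)
  · intro i hi h1 h2
    have h3 : i < n + 1 := by omega
    simpa [propC, propA, h3, hi] using hX' (Jc ⟨i, hi⟩) (Ja ⟨i, h3⟩)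
      (by simp [JGraph, Ja, Jc]) (by simpa [delC, hi] using h1) (by simpa [delA, h3] using h2)
  · intro i hi h1 h2
    have h4 : i + 1 < n + 1 := by omega
    simpa [propC, propA, h4, hi] using hX' (Jc ⟨i, hi⟩) (Ja ⟨i + 1, h4⟩)
      (by simp [JGraph, Ja, Jc]) (by simpa [delC, hi] using h1) (by simpa [delA, hi] using h2)
  · intro i hi h1 h2
    have h3 : i < n + 1 := by omega
    simpa [propC, propB, h3, hi] using hX' (Jc ⟨i, hi⟩) (Jb ⟨i, h3⟩)
      (by simp [JGraph, Jb, Jc]) (by simpa [delC, hi] using h1) (by simpa [delB, h3] using h2)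
  · intro i hi h1 h2
    have h4 : i + 1 < n + 1 := by omega
    simpa [propC, propB, h4, hi] using hX' (Jc ⟨i, hi⟩) (Jb ⟨i + 1, h4⟩)
      (by simp [JGraph, Jb, Jc]) (by simpa [delC, hi] using h1) (by simpa [delB, hi] using h2)
  · intro h1 h2
    simpa [propA, propB] using hX' (Ja 0) (Jb 0)
      (by simp [JGraph, Ja, Jb]) (by simpa [delA] using h1) (by simpa [delB] using h2)
  · intro h1 h2
    simpa [propA, propB] using hX' (Ja ⟨n, by omega⟩) (Jb ⟨n, by omega⟩)
      (by simp [JGraph, Ja, Jb]) (by simpa [delA] using h1) (by simpa [delB] using h2)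
  · intro h1 h2
    simpa [propA] using hX' (Ja 0) (Ja ⟨n, by omega⟩)
      (by
        refine (SimpleGraph.fromRel_adj _ _ _).2 ⟨fun h => ?_, Or.inr (by simp [Ja])⟩
        simp only [Ja, Sum.inl.injEq, Fin.ext_iff, Fin.val_zero] at h
        omega)
      (by simpa [delA] using h1)
      (by simpa [delA] using h2)
  · intro h1 h2
    simpa [propB] using hX' (Jb 0) (Jb ⟨n, by omega⟩)
      (by
        refine (SimpleGraph.fromRel_adj _ _ _).2 ⟨fun h => ?_, Or.inr (by simp [Jb])⟩
        simp only [Jb, Sum.inl.injEq, Sum.inr.injEq, Fin.ext_iff, Fin.val_zero] at h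
        omega)
      (by simpa [delB] using h1)
      (by simpa [delB] using h2)

theorem forall_of_cover {X : JVert (n + 1) → Prop}
    (h : (∀ i ≤ n, Col (delA S) (delB S) (propA X) (propB X) i) ∧
      ∀ i < n, ¬delC S i → propC X i) : ∀ v, v ∉ S → X v := by
  rintro (i | i | i) hi
  · exact (h.1 i (by omega)).1 (mt (delA_iff S i).1 hi) i.2
  · exact (h.1 i (by omega)).2 (mt (delB_iff S i).1 hi) i.2
  · exact h.2 i i.2 (mt (delC_iff S i).1 hi) i.2

theorem new_of_reps {X : JVert (n + 1) → Prop} (hR : ∀ r ∈ reps S, r ∉ S → X r) :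
    (∀ i < n, NewA (delA S) (delB S) (delC S) i → propA X (i + 1)) ∧
    (∀ i < n, NewB (delA S) (delB S) (delC S) i → propB X (i + 1)) ∧
    (∀ i < n, NewC (delA S) (delB S) (delC S) i → propC X i) := by
  refine ⟨fun i hi h hi' => hR _ ?_ ?_, fun i hi h hi' => hR _ ?_ ?_, fun i hi h hi' => hR _ ?_ ?_⟩
  · simpa [reps, Ja] using h
  · intro hmem; exact h.2.2.1 ⟨hi', hmem⟩
  · simpa [reps, Jb] using h
  · intro hmem; exact h.2.2.1 ⟨hi', hmem⟩
  · simpa [reps, Jc] using h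
  · intro hmem; exact h.2.2 ⟨hi', hmem⟩

theorem col_zero_of_firstRep (hn : 0 < n) {X : JVert (n + 1) → Prop}
    (hX : ∀ u v, u ∉ S → v ∉ S → (JGraph (n + 1)).Adj u v → X u → X v)
    (h : firstRep S ∉ S → X (firstRep S)) : Col (delA S) (delB S) (propA X) (propB X) 0 := by
  refine (closed_of_adj hn hX).col_zero (fun ha _ => ?_) (fun ha hb _ => ?_)
  · rw [firstRep, if_neg ha] at h
    exact h (by simpa [delA] using ha)
  · rw [firstRep, if_pos ha] at h
    exact h (by simpa [delB] using hb)

/-- The number of components of `J - S`. -/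
noncomputable abbrev numComponents (S : Finset (JVert (n + 1))) : ℕ :=
  Nat.card ((JGraph (n + 1)).induce (↑S : Set (JVert (n + 1)))ᶜ).ConnectedComponent

theorem numComponents_le_card_reps_add_one (hn : 0 < n) :
    numComponents S ≤ (reps S).card + 1 := by
  refine (card_components_le _ _ (insert (firstRep S) (reps S)) fun X hX hR => ?_).trans
    (Finset.card_insert_le _ _)
  simp only [Finset.mem_coe] at hX hR ⊢
  obtain ⟨hA, hB, hC⟩ := new_of_reps fun r hr => hR r (Finset.mem_insert_of_mem hr)
  exact forall_of_cover ((closed_of_adj hn hX).cover hA hB hC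
    (col_zero_of_firstRep hn hX (hR _ (Finset.mem_insert_self _ _))))

theorem numComponents_le_card_reps (hn : 0 < n)
    (h : (delA S 0 ∧ delB S 0) ∨ ((∃ i ≤ n, Sep (delA S) (delB S) (delC S) i) ∧
      ((¬delA S 0 ∧ ¬delA S n) ∨ (¬delB S 0 ∧ ¬delB S n)))) :
    numComponents S ≤ (reps S).card := by
  refine card_components_le _ _ _ fun X hX hR => ?_
  simp only [Finset.mem_coe] at hX hR ⊢
  obtain ⟨hA, hB, hC⟩ := new_of_reps hR
  have hcl := closed_of_adj hn hX
  refine forall_of_cover (hcl.cover hA hB hC ?_)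
  rcases h with h | ⟨hs, hw⟩
  · exact ⟨fun x => absurd h.1 x, fun x => absurd h.2 x⟩
  · exact hcl.col_zero_of_sep hA hB hC (fun ⟨h, _⟩ => h.false) hs hw

theorem numComponents_le_one_of_three {j : ℕ} (hj : j + 1 < n) (hS : S.card ≤ 3)
    (h : (delA S j ∨ delB S j) ∧ delC S j ∧ delC S (j + 1)) : numComponents S ≤ 1 := by
  have hn : 0 < n := by omega
  refine (card_components_le _ _ {firstRep S} fun X hX hR => ?_).trans (by simp)
  simp only [Finset.mem_coe] at hX hR ⊢
  have hcol := col_zero_of_firstRep hn hX (hR _ (Finset.mem_singleton_self _))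
  have hcl := closed_of_adj hn hX
  apply forall_of_cover
  obtain ⟨ha | hb, ⟨hj1, hc1⟩, ⟨hj2, hc2⟩⟩ := h
  · obtain ⟨hj0, ha⟩ := ha
    have hSeq : {Ja ⟨j, hj0⟩, Jc ⟨j, hj1⟩, Jc ⟨j + 1, hj2⟩} = S :=
      Finset.eq_of_subset_of_card_le (by simp [Finset.insert_subset_iff, *])
        (hS.trans (by simp [Ja, Jc]))
    refine hcl.cover_of_three hj (j := j) (fun i => ?_) (fun i => ?_) (fun i => ?_) hcol
    · simp only [delA, ← hSeq, Ja, Jc]; simp; omega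
    · simp [delB, ← hSeq, Ja, Jb, Jc]
    · simp only [delC, ← hSeq, Ja, Jc]; simp; omega
  · obtain ⟨hj0, hb⟩ := hb
    have hSeq : {Jb ⟨j, hj0⟩, Jc ⟨j, hj1⟩, Jc ⟨j + 1, hj2⟩} = S :=
      Finset.eq_of_subset_of_card_le (by simp [Finset.insert_subset_iff, *])
        (hS.trans (by simp [Jb, Jc]))
    have := hcl.swap.cover_of_three hj (j := j) (fun i => ?_) (fun i => ?_) (fun i => ?_) hcol.symm
    · exact ⟨fun i hi => (this.1 i hi).symm, this.2⟩
    · simp only [delB, ← hSeq, Jb, Jc]; simp; omega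
    · simp [delA, ← hSeq, Ja, Jb, Jc]
    · simp only [delC, ← hSeq, Jb, Jc]; simp; omega

theorem two_mul_numComponents_le (hn : 0 < n) (hev : Even n) (h2 : 2 ≤ numComponents S) :
    2 * numComponents S ≤ S.card := by
  have hcn : ¬delC S n := fun ⟨h, _⟩ => h.false
  have hdebt : debt (delA S) (delB S) (delC S) n = 0 := by simp [debt, hcn]
  have hcard := card_eq_sum_delCount S
  have hreps := card_reps S
  have hle := two_mul_sum_newCount_le (a := delA S) (b := delB S) (c := delC S) n
  have hk := numComponents_le_card_reps_add_one (S := S) hn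
  by_cases h0 : delA S 0 ∧ delB S 0
  · have := numComponents_le_card_reps hn (Or.inl h0)
    omega
  by_cases hw : (¬delA S 0 ∧ ¬delA S n) ∨ (¬delB S 0 ∧ ¬delB S n)
  · by_cases hs : ∃ i ≤ n, Sep (delA S) (delB S) (delC S) i
    · have := numComponents_le_card_reps hn (Or.inr ⟨hs, hw⟩)
      omega
    push Not at hs
    have h3 := three_mul_sum_newCount_le n hs
    by_contra hlt
    have hS3 : S.card ≤ 3 := by omega
    obtain ⟨j, hj, hpos⟩ : ∃ j < n, newCount (delA S) (delB S) (delC S) j ≠ 0 := by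
      by_contra! hzero
      rw [Finset.sum_eq_zero fun i hi => hzero i (Finset.mem_range.1 hi)] at hreps
      omega
    have hthree := del_of_newCount_ne_zero (hs j hj.le) hpos
    have := numComponents_le_one_of_three hthree.2.2.1 hS3 hthree
    omega
  · by_cases h1 : delA S n ∧ delB S n
    · simp only [h1, if_true] at hcard
      omega
    · have halt := two_mul_sum_newCount_lt_or (a := delA S) (b := delB S) (c := delC S)
        (by clear * - h0 hw h1; tauto) n
      rw [if_pos hev] at halt
      have hone : (if delA S n then 1 else 0) + (if delB S n then 1 else 0) = 1 := by
        clear * - h0 hw h1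
        split_ifs <;> tauto
      rcases halt with halt | halt
      · omega
      · clear * - h0 hw h1 halt
        tauto

end Graph

end JLadder

/-- For every odd `m ≥ 3`, the graph `J_m` is 2-tough. -/
theorem stmt_7 (m : ℕ) (hm : 3 ≤ m) (hodd : Odd m)
    (S : Finset (JVert m)) (hS : IsCutset (JGraph m) ↑S) :
    2 * Nat.card ((JGraph m).induce (↑S : Set (JVert m))ᶜ).ConnectedComponent ≤ S.card := by
  obtain ⟨n, rfl⟩ : ∃ n, m = n + 1 := ⟨m - 1, by omega⟩
  refine JLadder.two_mul_numComponents_le (by omega) ?_ hS.two_le_card_components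
  simpa [Nat.odd_add_one] using hodd
end

section
/- For every odd integer m ≥ 3, the toughness of J_m equals 2: for every cut-set S of J_m one has 2·k(J_m − S) ≤ |S|, and there exists a cut-set S of J_m with |S| = 2·k(J_m − S). -/
/-- Two vertex labels are compatible if one is missing or they agree. -/
def LabelCompat {α : Type*} (x y : Option α) : Prop :=
  ∀ u ∈ x, ∀ v ∈ y, u = v

/-- `1` if the label is missing, `0` otherwise. -/
def holeCount {α : Type*} : Option α → ℕ
  | none => 1
  | some _ => 0

/-- Labels occurring in the columns `0, …, n` of a strip. -/
def stripLabels {α : Type*} [DecidableEq α] (a b c : ℕ → Option α) : ℕ → Finset α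
  | 0 => (a 0).toFinset ∪ (b 0).toFinset
  | n + 1 => (a (n + 1)).toFinset ∪ ((b (n + 1)).toFinset ∪
      ((c n).toFinset ∪ stripLabels a b c n))

/-- Number of missing labels in the columns `0, …, n` of a strip. -/
def stripHoles {α : Type*} (a b c : ℕ → Option α) : ℕ → ℕ
  | 0 => holeCount (a 0) + holeCount (b 0)
  | n + 1 => stripHoles a b c n + holeCount (a (n + 1)) + holeCount (b (n + 1)) + holeCount (c n)

theorem stripHoles_swap {α : Type*} (a b c : ℕ → Option α) (n : ℕ) :
    stripHoles b a c n = stripHoles a b c n := by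
  induction n with
  | zero => exact Nat.add_comm _ _
  | succ n ih => simp only [stripHoles, ih]; omega

theorem stripHoles_eq_sum {α : Type*} (a b c : ℕ → Option α) (n : ℕ) :
    stripHoles a b c n = ∑ i ∈ Finset.range (n + 1), holeCount (a i) +
      (∑ i ∈ Finset.range (n + 1), holeCount (b i) + ∑ i ∈ Finset.range n, holeCount (c i)) := by
  induction n with
  | zero => simp [stripHoles]
  | succ n ih =>
    rw [stripHoles, ih, Finset.sum_range_succ (fun i => holeCount (a i)) (n + 1),
      Finset.sum_range_succ (fun i => holeCount (b i)) (n + 1),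
      Finset.sum_range_succ (fun i => holeCount (c i)) n]
    omega

section Invariants

variable {α : Type*} [DecidableEq α]

/-- The invariant for strips whose first column is entirely missing: `p`, `q` are the labels in
the last column, `k` is the number of labels and `N` the number of holes. -/
def EmptyInv (p q : Option α) (k N : ℕ) : Prop :=
  match p, q with
  | none, none => 2 * k + 2 ≤ N
  | none, some _ => 2 * k + 1 ≤ N
  | some _, none => 2 * k + 1 ≤ N
  | some x, some y => if x = y then 2 * k ≤ N else 2 * k ≤ N + 1

/-- The invariant for strips whose first column is entirely labelled by `u`. -/
def FullInv (u : α) (p q : Option α) (k N : ℕ) : Prop :=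
  match p, q with
  | none, none => 2 * k ≤ N
  | none, some x => if x = u ∧ 2 ≤ k then 2 * k ≤ N else 2 * k ≤ N + 1
  | some x, none => if x = u ∧ 2 ≤ k then 2 * k ≤ N else 2 * k ≤ N + 1
  | some x, some y =>
    if x = y then (if x = u ∧ 2 ≤ k then 2 * k ≤ N else 2 * k ≤ N + 2)
    else (if x = u ∨ y = u then 2 * k ≤ N + 2 else 2 * k ≤ N + 3)

/-- The invariant for strips whose first column is missing its `a`-label and has `b`-label `u`;
`n` is the index of the last column. -/
def HalfInv (u : α) (n : ℕ) (p q : Option α) (k N : ℕ) : Prop :=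
  match p, q with
  | none, none => 2 * k + 1 ≤ N
  | none, some x =>
    if x = u ∧ 2 ≤ k then 2 * k ≤ N
    else if n % 2 = 0 then 2 * k ≤ N + 1 else 2 * k ≤ N
  | some x, none =>
    if x = u then (if 2 ≤ k then 2 * k + 1 ≤ N else 2 * k ≤ N)
    else if n % 2 = 0 then 2 * k ≤ N else 2 * k ≤ N + 1
  | some x, some y =>
    if x = y then (if x = u ∧ 2 ≤ k then 2 * k ≤ N else 2 * k ≤ N + 1)
    else if x = u then 2 * k ≤ N + 1
    else if y = u then (if n % 2 = 0 then 2 * k ≤ N + 1 else 2 * k ≤ N + 2)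
    else 2 * k ≤ N + 2

theorem EmptyInv.step {L : Finset α} {p q r s t : Option α} {N : ℕ}
    (hp : p.toFinset ⊆ L) (hq : q.toFinset ⊆ L)
    (h : EmptyInv p q L.card N)
    (hpr : LabelCompat p r) (hqr : LabelCompat q r) (hrs : LabelCompat r s)
    (hrt : LabelCompat r t) (hps : LabelCompat p s) (hqt : LabelCompat q t) :
    EmptyInv s t (s.toFinset ∪ (t.toFinset ∪ (r.toFinset ∪ L))).card
      (N + holeCount s + holeCount t + holeCount r) := by
  rcases p with _ | p <;> rcases q with _ | q <;> rcases r with _ | r <;>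
    rcases s with _ | s <;> rcases t with _ | t <;>
    simp only [EmptyInv, LabelCompat, holeCount, Option.toFinset_none, Option.toFinset_some,
      Finset.empty_union, Finset.singleton_union, Finset.card_insert_eq_ite,
      Finset.singleton_subset_iff, Finset.mem_insert, Option.mem_def, Option.some.injEq,
      forall_eq'] at * <;>
    grind

theorem FullInv.step {L : Finset α} {u : α} {p q r s t : Option α} {N : ℕ}
    (hu : u ∈ L) (hp : p.toFinset ⊆ L) (hq : q.toFinset ⊆ L)
    (h : FullInv u p q L.card N)
    (hpr : LabelCompat p r) (hqr : LabelCompat q r) (hrs : LabelCompat r s)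
    (hrt : LabelCompat r t) (hps : LabelCompat p s) (hqt : LabelCompat q t) :
    FullInv u s t (s.toFinset ∪ (t.toFinset ∪ (r.toFinset ∪ L))).card
      (N + holeCount s + holeCount t + holeCount r) := by
  have hL : ∀ x ∈ L, ∀ y ∈ L, x ≠ y → 2 ≤ L.card :=
    fun x hx y hy hxy => Finset.one_lt_card.mpr ⟨x, hx, y, hy, hxy⟩
  have hL' : 1 ≤ L.card := Finset.card_pos.mpr ⟨u, hu⟩
  rcases p with _ | p <;> rcases q with _ | q <;> rcases r with _ | r <;>
    rcases s with _ | s <;> rcases t with _ | t <;>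
    simp only [FullInv, LabelCompat, holeCount, Option.toFinset_none, Option.toFinset_some,
      Finset.empty_union, Finset.singleton_union, Finset.card_insert_eq_ite,
      Finset.singleton_subset_iff, Finset.mem_insert, Option.mem_def, Option.some.injEq,
      forall_eq'] at * <;>
    grind

theorem HalfInv.step {L : Finset α} {u : α} {n : ℕ} {p q r s t : Option α} {N : ℕ}
    (hu : u ∈ L) (hp : p.toFinset ⊆ L) (hq : q.toFinset ⊆ L)
    (h : HalfInv u n p q L.card N)
    (hpr : LabelCompat p r) (hqr : LabelCompat q r) (hrs : LabelCompat r s)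
    (hrt : LabelCompat r t) (hps : LabelCompat p s) (hqt : LabelCompat q t) :
    HalfInv u (n + 1) s t (s.toFinset ∪ (t.toFinset ∪ (r.toFinset ∪ L))).card
      (N + holeCount s + holeCount t + holeCount r) := by
  have hL : ∀ x ∈ L, ∀ y ∈ L, x ≠ y → 2 ≤ L.card :=
    fun x hx y hy hxy => Finset.one_lt_card.mpr ⟨x, hx, y, hy, hxy⟩
  have hL' : 1 ≤ L.card := Finset.card_pos.mpr ⟨u, hu⟩
  rcases Nat.mod_two_eq_zero_or_one n with hn | hn
  all_goals
    have hn' : (n + 1) % 2 = 1 - n % 2 := by omega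
    rw [hn] at hn'
    rcases p with _ | p <;> rcases q with _ | q <;> rcases r with _ | r <;>
      rcases s with _ | s <;> rcases t with _ | t <;>
      simp only [HalfInv, hn, hn', LabelCompat, holeCount, Option.toFinset_none,
        Option.toFinset_some, Finset.empty_union, Finset.singleton_union,
        Finset.card_insert_eq_ite, Finset.singleton_subset_iff, Finset.mem_insert,
        Option.mem_def, Option.some.injEq, forall_eq'] at * <;>
      grind

end Invariants

section Strip

variable {α : Type*} [DecidableEq α] {a b c : ℕ → Option α} {n : ℕ}

theorem toFinset_subset_stripLabels (a b c : ℕ → Option α) (n : ℕ) :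
    (a n).toFinset ⊆ stripLabels a b c n ∧ (b n).toFinset ⊆ stripLabels a b c n := by
  cases n <;> simp only [stripLabels] <;> constructor <;> intro x hx <;>
    simp only [Finset.mem_union, hx, true_or, or_true]

theorem stripLabels_zero_subset (a b c : ℕ → Option α) (n : ℕ) :
    stripLabels a b c 0 ⊆ stripLabels a b c n := by
  induction n with
  | zero => exact subset_rfl
  | succ n ih =>
    refine ih.trans fun x hx => ?_
    simp only [stripLabels.eq_2, Finset.mem_union, hx, or_true]

theorem stripLabels_swap (a b c : ℕ → Option α) (n : ℕ) :
    stripLabels b a c n = stripLabels a b c n := by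
  induction n with
  | zero => exact Finset.union_comm _ _
  | succ n ih => simp only [stripLabels, ih, Finset.union_left_comm]

/-- The labels of a strip are compatible along the edges of its triangles. -/
def StripCompat (a b c : ℕ → Option α) (n : ℕ) : Prop :=
  ∀ i < n, LabelCompat (a i) (c i) ∧ LabelCompat (b i) (c i) ∧
    LabelCompat (c i) (a (i + 1)) ∧ LabelCompat (c i) (b (i + 1)) ∧
    LabelCompat (a i) (a (i + 1)) ∧ LabelCompat (b i) (b (i + 1))

theorem two_mul_card_stripLabels_le_of_empty (ha : a 0 = none) (hb : b 0 = none)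
    (h : StripCompat a b c n) (hend : LabelCompat (a n) (b n)) :
    2 * (stripLabels a b c n).card ≤ stripHoles a b c n := by
  have key : ∀ i ≤ n, EmptyInv (a i) (b i) (stripLabels a b c i).card (stripHoles a b c i) := by
    intro i
    induction i with
    | zero => simp [EmptyInv, stripLabels, stripHoles, holeCount, ha, hb]
    | succ i ih =>
      intro hi
      obtain ⟨h1, h2, h3, h4, h5, h6⟩ := h i hi
      obtain ⟨hp, hq⟩ := toFinset_subset_stripLabels a b c i
      exact (ih (by omega)).step hp hq h1 h2 h3 h4 h5 h6
  have := key n le_rfl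
  revert this hend
  rcases a n with _ | x <;> rcases b n with _ | y <;> 
    simp only [EmptyInv, LabelCompat, Option.mem_def, Option.some.injEq, forall_eq'] <;> grind

theorem two_mul_card_stripLabels_le_of_full {u : α} (ha : a 0 = some u) (hb : b 0 = some u)
    (h : StripCompat a b c n) (hwa : LabelCompat (a n) (a 0)) (hwb : LabelCompat (b n) (b 0))
    (hk : 2 ≤ (stripLabels a b c n).card) :
    2 * (stripLabels a b c n).card ≤ stripHoles a b c n := by
  have key : ∀ i ≤ n, FullInv u (a i) (b i) (stripLabels a b c i).card (stripHoles a b c i) := by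
    intro i
    induction i with
    | zero => simp [FullInv, stripLabels, stripHoles, holeCount, ha, hb]
    | succ i ih =>
      intro hi
      obtain ⟨h1, h2, h3, h4, h5, h6⟩ := h i hi
      obtain ⟨hp, hq⟩ := toFinset_subset_stripLabels a b c i
      exact (ih (by omega)).step (stripLabels_zero_subset a b c i (by simp [stripLabels, ha]))
        hp hq h1 h2 h3 h4 h5 h6
  have := key n le_rfl
  rw [ha] at hwa
  rw [hb] at hwb
  revert this hwa hwb
  rcases a n with _ | x <;> rcases b n with _ | y <;> 
    simp only [FullInv, LabelCompat, Option.mem_def, Option.some.injEq, forall_eq'] <;> grind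

theorem two_mul_card_stripLabels_le_of_half {u : α} (ha : a 0 = none) (hb : b 0 = some u)
    (hn : Even n) (h : StripCompat a b c n) (hend : LabelCompat (a n) (b n))
    (hwb : LabelCompat (b n) (b 0)) (hk : 2 ≤ (stripLabels a b c n).card) :
    2 * (stripLabels a b c n).card ≤ stripHoles a b c n := by
  have key : ∀ i ≤ n, HalfInv u i (a i) (b i) (stripLabels a b c i).card (stripHoles a b c i) := by
    intro i
    induction i with
    | zero => simp [HalfInv, stripLabels, stripHoles, holeCount, ha, hb]
    | succ i ih =>
      intro hi
      obtain ⟨h1, h2, h3, h4, h5, h6⟩ := h i hi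
      obtain ⟨hp, hq⟩ := toFinset_subset_stripLabels a b c i
      exact (ih (by omega)).step (stripLabels_zero_subset a b c i (by simp [stripLabels, hb]))
        hp hq h1 h2 h3 h4 h5 h6
  have := key n le_rfl
  rw [hb] at hwb
  have hn' := Nat.even_iff.mp hn
  revert this hend hwb
  rcases a n with _ | x <;> rcases b n with _ | y <;>
    simp only [HalfInv, LabelCompat, hn', Option.mem_def, Option.some.injEq, forall_eq'] <;>
    grind

theorem two_mul_card_stripLabels_le (hn : Even n) (h : StripCompat a b c n)
    (hstart : LabelCompat (a 0) (b 0)) (hend : LabelCompat (a n) (b n))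
    (hwa : LabelCompat (a n) (a 0)) (hwb : LabelCompat (b n) (b 0))
    (hk : 2 ≤ (stripLabels a b c n).card) :
    2 * (stripLabels a b c n).card ≤ stripHoles a b c n := by
  rcases ha : a 0 with _ | u <;> rcases hb : b 0 with _ | v
  · exact two_mul_card_stripLabels_le_of_empty ha hb h hend
  · exact two_mul_card_stripLabels_le_of_half ha hb hn h hend hwb hk
  · rw [← stripLabels_swap, ← stripHoles_swap]
    rw [← stripLabels_swap] at hk
    refine two_mul_card_stripLabels_le_of_half hb ha hn (fun i hi => ?_)
      (fun x hx y hy => (hend y hy x hx).symm) hwa hk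
    obtain ⟨h1, h2, h3, h4, h5, h6⟩ := h i hi
    exact ⟨h2, h1, h4, h3, h6, h5⟩
  · obtain rfl : u = v := hstart u (by simp [ha]) v (by simp [hb])
    exact two_mul_card_stripLabels_le_of_full ha hb h hwa hwb hk

theorem mem_stripLabels {x : α} : x ∈ stripLabels a b c n ↔
    (∃ i ≤ n, x ∈ a i) ∨ (∃ i ≤ n, x ∈ b i) ∨ ∃ i < n, x ∈ c i := by
  induction n with
  | zero => simp [stripLabels]
  | succ n ih =>
    simp only [stripLabels, Finset.mem_union, ih, Option.mem_toFinset,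
      Nat.lt_succ_iff_lt_or_eq, Nat.le_succ_iff, or_and_right, exists_or, exists_eq_left,
      Nat.succ_eq_add_one]
    grind

end Strip

/-- The component of a vertex outside `S`, and `none` for a vertex of `S`. -/
noncomputable def componentLabel {V : Type*} (G : SimpleGraph V) (S : Set V) (v : V) :
    Option (G.induce Sᶜ).ConnectedComponent :=
  open Classical in
  if h : v ∈ Sᶜ then some ((G.induce Sᶜ).connectedComponentMk ⟨v, h⟩) else none

theorem mem_componentLabel {V : Type*} {G : SimpleGraph V} {S : Set V} {v : V}
    {K : (G.induce Sᶜ).ConnectedComponent} : K ∈ componentLabel G S v ↔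
      ∃ h : v ∈ Sᶜ, (G.induce Sᶜ).connectedComponentMk ⟨v, h⟩ = K := by
  unfold componentLabel
  split_ifs with h <;> simp_all

theorem holeCount_componentLabel {V : Type*} (G : SimpleGraph V) (S : Finset V)
    [DecidableEq V] (v : V) :
    holeCount (componentLabel G (S : Set V) v) = if v ∈ S then 1 else 0 := by
  unfold componentLabel
  by_cases h : v ∈ S <;> simp [h, holeCount]

theorem SimpleGraph.Adj.labelCompat {V : Type*} {G : SimpleGraph V} {S : Set V} {v w : V}
    (h : G.Adj v w) : LabelCompat (componentLabel G S v) (componentLabel G S w) := by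
  intro K hK K' hK'
  obtain ⟨hv, rfl⟩ := mem_componentLabel.mp hK
  obtain ⟨hw, rfl⟩ := mem_componentLabel.mp hK'
  exact SimpleGraph.ConnectedComponent.sound (SimpleGraph.Adj.reachable h)

theorem IsCutset.one_lt_card_connectedComponent {V : Type*} [Finite V] {G : SimpleGraph V}
    {S : Set V} (h : IsCutset G S) : 1 < Nat.card (G.induce Sᶜ).ConnectedComponent := by
  obtain ⟨hne, hnc⟩ := h
  have : Nonempty ↑Sᶜ := hne.nonempty.to_subtype
  rw [SimpleGraph.connected_iff] at hnc
  have hp : ¬ (G.induce Sᶜ).Preconnected := fun hp => hnc ⟨hp, this⟩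
  simp only [SimpleGraph.Preconnected, not_forall] at hp
  obtain ⟨v, w, hvw⟩ := hp
  have : Nontrivial (G.induce Sᶜ).ConnectedComponent :=
    ⟨_, _, fun he => hvw (SimpleGraph.ConnectedComponent.exact he)⟩
  exact Finite.one_lt_card

theorem JGraph_toughness_bound {m : ℕ} (hm : 3 ≤ m) (hodd : Odd m) (S : Finset (JVert m))
    (hS : IsCutset (JGraph m) (S : Set (JVert m))) :
    2 * Nat.card ((JGraph m).induce (S : Set (JVert m))ᶜ).ConnectedComponent ≤ S.card := by
  classical
  obtain ⟨n, rfl⟩ : ∃ n, m = n + 1 := ⟨m - 1, by omega⟩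
  have hn : Even n := by
    rcases Nat.even_or_odd n with h | h
    · exact h
    · exact absurd hodd (Nat.not_odd_iff_even.mpr h.add_one)
  set G := JGraph (n + 1) with hG
  let f := componentLabel G (S : Set (JVert (n + 1)))
  let a : ℕ → Option (G.induce (S : Set (JVert (n + 1)))ᶜ).ConnectedComponent :=
    fun i => if h : i < n + 1 then f (Ja ⟨i, h⟩) else none
  let b : ℕ → Option (G.induce (S : Set (JVert (n + 1)))ᶜ).ConnectedComponent :=
    fun i => if h : i < n + 1 then f (Jb ⟨i, h⟩) else none
  let c : ℕ → Option (G.induce (S : Set (JVert (n + 1)))ᶜ).ConnectedComponent :=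
    fun i => if h : i < n then f (Jc ⟨i, h⟩) else none
  have ha : ∀ i (h : i < n + 1), a i = f (Ja ⟨i, h⟩) := fun i h => dif_pos h
  have hb : ∀ i (h : i < n + 1), b i = f (Jb ⟨i, h⟩) := fun i h => dif_pos h
  have hc : ∀ i (h : i < n), c i = f (Jc ⟨i, h⟩) := fun i h => dif_pos h
  have huniv : stripLabels a b c n = Finset.univ := by
    refine Finset.eq_univ_of_forall fun K => mem_stripLabels.mpr ?_
    obtain ⟨⟨v, hv⟩, rfl⟩ := K.exists_rep
    have hmem : (G.induce (S : Set (JVert (n + 1)))ᶜ).connectedComponentMk ⟨v, hv⟩ ∈ f v :=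
      mem_componentLabel.mpr ⟨hv, rfl⟩
    rcases v with ⟨i, hi⟩ | ⟨i, hi⟩ | ⟨i, hi⟩
    · exact .inl ⟨i, by omega, by rw [ha i hi]; exact hmem⟩
    · exact .inr (.inl ⟨i, by omega, by rw [hb i hi]; exact hmem⟩)
    · exact .inr (.inr ⟨i, hi, by rw [hc i hi]; exact hmem⟩)
  have hholes : stripHoles a b c n = S.card := by
    have hcard : S.card = ∑ v : JVert (n + 1), holeCount (f v) := by
      simp only [f, holeCount_componentLabel, Finset.sum_boole, Finset.filter_mem_eq_inter,
        Finset.univ_inter, Nat.cast_id]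
    rw [stripHoles_eq_sum, hcard, Fintype.sum_sum_type, Fintype.sum_sum_type,
      ← Fin.sum_univ_eq_sum_range, ← Fin.sum_univ_eq_sum_range, ← Fin.sum_univ_eq_sum_range]
    refine congrArg₂ _ (Finset.sum_congr rfl fun i _ => ?_)
      (congrArg₂ _ (Finset.sum_congr rfl fun i _ => ?_) (Finset.sum_congr rfl fun i _ => ?_))
    · rw [ha i i.2]; rfl
    · rw [hb i i.2]; rfl
    · rw [hc i i.2]; rfl
  have hcompat : StripCompat a b c n := by
    intro i hi
    rw [ha i (by omega), hb i (by omega), hc i hi, ha (i + 1) (by omega), hb (i + 1) (by omega)]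
    refine ⟨?_, ?_, ?_, ?_, ?_, ?_⟩ <;> apply SimpleGraph.Adj.labelCompat <;>
      simp [hG, JGraph, Ja, Jb, Jc, Nat.mod_eq_of_lt, hi]
  have hends : LabelCompat (a 0) (b 0) ∧ LabelCompat (a n) (b n) ∧ LabelCompat (a n) (a 0) ∧
      LabelCompat (b n) (b 0) := by
    rw [ha 0 (by omega), hb 0 (by omega), ha n (by omega), hb n (by omega)]
    refine ⟨?_, ?_, ?_, ?_⟩ <;> apply SimpleGraph.Adj.labelCompat <;>
      simp [hG, JGraph, Ja, Jb] <;> omega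
  have hk := hS.one_lt_card_connectedComponent
  rw [Nat.card_eq_fintype_card, ← Finset.card_univ, ← huniv] at hk ⊢
  rw [← hholes]
  exact two_mul_card_stripLabels_le hn hcompat hends.1 hends.2.1 hends.2.2.1 hends.2.2.2 hk

theorem exists_isCutset_JGraph_card_eq_four {m : ℕ} (hm : 3 ≤ m) :
    ∃ S : Finset (JVert m), IsCutset (JGraph m) (S : Set (JVert m)) ∧ S.card = 4 := by
  let S : Finset (JVert m) := {Ja ⟨0, by omega⟩, Ja ⟨2, by omega⟩, Jc ⟨0, by omega⟩,
    Jc ⟨1, by omega⟩}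
  have hv : (Ja ⟨1, by omega⟩ : JVert m) ∈ (S : Set (JVert m))ᶜ := by simp [S, Ja, Jc]
  have hw : (Jb ⟨0, by omega⟩ : JVert m) ∈ (S : Set (JVert m))ᶜ := by simp [S, Ja, Jb, Jc]
  have hne : (Ja ⟨1, by omega⟩ : JVert m) ≠ Jb ⟨0, by omega⟩ := by simp [Ja, Jb]
  refine ⟨S, ⟨⟨_, hv, _, hw, hne⟩, fun hconn => ?_⟩, by simp [S, Ja, Jc]⟩
  obtain ⟨p⟩ := hconn.preconnected ⟨_, hv⟩ ⟨_, hw⟩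
  cases p with
  | @cons _ x _ hadj _ =>
    obtain ⟨x, hx⟩ := x
    have hadj' : (JGraph m).Adj (Ja ⟨1, by omega⟩) x := hadj
    have hm2 : 1 + 1 < m := by omega
    rcases x with ⟨i, hi⟩ | ⟨i, hi⟩ | ⟨i, hi⟩
    · simp only [S, Ja, Jc, JGraph, SimpleGraph.fromRel_adj] at hadj' hx
      have : 1 = (i + 1) % m → i = 0 := by
        intro h
        rcases Nat.lt_or_ge (i + 1) m with h' | h'
        · rw [Nat.mod_eq_of_lt h'] at h; omega
        · rw [show i + 1 = m by omega, Nat.mod_self] at h; omega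
      rw [Nat.mod_eq_of_lt hm2] at hadj'
      simp at hx
      omega
    · simp [Ja, JGraph] at hadj'
      omega
    · simp [S, Ja, Jc, JGraph] at hadj' hx
      omega

/-- For every odd `m ≥ 3`, the toughness of `J_m` equals 2. -/
theorem stmt_8 (m : ℕ) (hm : 3 ≤ m) (hodd : Odd m) :
    (∀ S : Finset (JVert m), IsCutset (JGraph m) ↑S →
      2 * Nat.card ((JGraph m).induce (↑S : Set (JVert m))ᶜ).ConnectedComponent ≤ S.card) ∧
    (∃ S : Finset (JVert m), IsCutset (JGraph m) ↑S ∧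
      S.card = 2 * Nat.card ((JGraph m).induce (↑S : Set (JVert m))ᶜ).ConnectedComponent) := by
  refine ⟨JGraph_toughness_bound hm hodd, ?_⟩
  obtain ⟨S, hS, hcard⟩ := exists_isCutset_JGraph_card_eq_four hm
  have hle := JGraph_toughness_bound hm hodd S hS
  have hlt := hS.one_lt_card_connectedComponent
  exact ⟨S, hS, by omega⟩
end

section
/- For every odd integer m ≥ 5, there exists a 4-regular graph on 3m−1 vertices that is 2-tough and contains a claw; namely, J_m is 4-regular, for every cut-set S of J_m one has 2·k(J_m − S) ≤ |S|, and some vertex of J_m has three pairwise nonadjacent neighbors. -/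
namespace JGraph

section Adjacency

variable {m : ℕ}

lemma eq_succ_mod_iff {i j : ℕ} (hi : i < m) (hj : j < m) :
    j = (i + 1) % m ↔ j = i + 1 ∨ (i + 1 = m ∧ j = 0) := by
  rcases Nat.lt_or_ge (i + 1) m with h | h
  · rw [Nat.mod_eq_of_lt h]; omega
  · obtain rfl : m = i + 1 := by omega
    rw [Nat.mod_self]; omega

lemma adj_a_a (hm : 3 ≤ m) (i j : Fin m) :
    (JGraph m).Adj (Sum.inl i) (Sum.inl j) ↔
      (j : ℕ) = i + 1 ∨ (i : ℕ) = j + 1 ∨ ((i : ℕ) + 1 = m ∧ (j : ℕ) = 0) ∨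
        ((j : ℕ) + 1 = m ∧ (i : ℕ) = 0) := by
  simp only [JGraph, SimpleGraph.fromRel_adj, ne_eq, Sum.inl.injEq,
    eq_succ_mod_iff i.2 j.2, eq_succ_mod_iff j.2 i.2, Fin.ext_iff]
  omega

lemma adj_b_b (hm : 3 ≤ m) (i j : Fin m) :
    (JGraph m).Adj (Sum.inr (Sum.inl i)) (Sum.inr (Sum.inl j)) ↔
      (j : ℕ) = i + 1 ∨ (i : ℕ) = j + 1 ∨ ((i : ℕ) + 1 = m ∧ (j : ℕ) = 0) ∨
        ((j : ℕ) + 1 = m ∧ (i : ℕ) = 0) := by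
  simp only [JGraph, SimpleGraph.fromRel_adj, ne_eq, Sum.inr.injEq, Sum.inl.injEq,
    eq_succ_mod_iff i.2 j.2, eq_succ_mod_iff j.2 i.2, Fin.ext_iff]
  omega

lemma adj_a_b (i j : Fin m) :
    (JGraph m).Adj (Sum.inl i) (Sum.inr (Sum.inl j)) ↔
      (i : ℕ) = j ∧ ((i : ℕ) = 0 ∨ (i : ℕ) + 1 = m) := by
  have := i.2
  simp [JGraph]
  omega

lemma adj_c_a (i : Fin (m - 1)) (j : Fin m) :
    (JGraph m).Adj (Sum.inr (Sum.inr i)) (Sum.inl j) ↔ (j : ℕ) = i ∨ (j : ℕ) = i + 1 := by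
  simp [JGraph]

lemma adj_c_b (i : Fin (m - 1)) (j : Fin m) :
    (JGraph m).Adj (Sum.inr (Sum.inr i)) (Sum.inr (Sum.inl j)) ↔
      (j : ℕ) = i ∨ (j : ℕ) = i + 1 := by
  simp [JGraph]

lemma not_adj_c_c (i j : Fin (m - 1)) :
    ¬ (JGraph m).Adj (Sum.inr (Sum.inr i)) (Sum.inr (Sum.inr j)) := by
  simp [JGraph]

end Adjacency

section Degree

variable {m : ℕ}

lemma degree_eq_four {v w₁ w₂ w₃ w₄ : JVert m} (h : [w₁, w₂, w₃, w₄].Nodup)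
    (hv : ∀ w, (JGraph m).Adj v w ↔ w ∈ [w₁, w₂, w₃, w₄]) : (JGraph m).degree v = 4 := by
  have : (JGraph m).neighborFinset v = [w₁, w₂, w₃, w₄].toFinset := by
    ext w
    rw [SimpleGraph.mem_neighborFinset, hv, List.mem_toFinset]
  rw [← SimpleGraph.card_neighborFinset_eq_degree, this, List.toFinset_card_of_nodup h]
  rfl

lemma degree_c (i : Fin (m - 1)) : (JGraph m).degree (Sum.inr (Sum.inr i)) = 4 := by
  have hi := i.2
  refine degree_eq_four (w₁ := Sum.inl ⟨i, by omega⟩) (w₂ := Sum.inl ⟨i + 1, by omega⟩)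
    (w₃ := Sum.inr (Sum.inl ⟨i, by omega⟩)) (w₄ := Sum.inr (Sum.inl ⟨i + 1, by omega⟩))
    (by simp) ?_
  rintro (j | j | j)
  · simp [adj_c_a, Fin.ext_iff]
  · simp [adj_c_b, Fin.ext_iff]
  · simp [not_adj_c_c]

lemma degree_a (hm : 3 ≤ m) (i : Fin m) : (JGraph m).degree (Sum.inl i) = 4 := by
  have hi := i.2
  rcases Nat.eq_zero_or_pos (i : ℕ) with h0 | h0
  · refine degree_eq_four (w₁ := Sum.inl ⟨1, by omega⟩) (w₂ := Sum.inl ⟨m - 1, by omega⟩)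
      (w₃ := Sum.inr (Sum.inl ⟨0, by omega⟩)) (w₄ := Sum.inr (Sum.inr ⟨0, by omega⟩))
      (by simp; omega) ?_
    rintro (j | j | j)
    · simp [adj_a_a hm, Fin.ext_iff]; omega
    · simp [adj_a_b, Fin.ext_iff]; omega
    · simp [SimpleGraph.adj_comm _ (Sum.inl i), adj_c_a, Fin.ext_iff]; omega
  rcases Nat.lt_or_ge (i + 1) m with h1 | h1
  · refine degree_eq_four (w₁ := Sum.inl ⟨i + 1, by omega⟩) (w₂ := Sum.inl ⟨i - 1, by omega⟩)
      (w₃ := Sum.inr (Sum.inr ⟨i, by omega⟩)) (w₄ := Sum.inr (Sum.inr ⟨i - 1, by omega⟩))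
      (by simp; omega) ?_
    rintro (j | j | j)
    · simp [adj_a_a hm, Fin.ext_iff]; omega
    · simp [adj_a_b]; omega
    · simp [SimpleGraph.adj_comm _ (Sum.inl i), adj_c_a, Fin.ext_iff]; omega
  · refine degree_eq_four (w₁ := Sum.inl ⟨0, by omega⟩) (w₂ := Sum.inl ⟨i - 1, by omega⟩)
      (w₃ := Sum.inr (Sum.inl i)) (w₄ := Sum.inr (Sum.inr ⟨i - 1, by omega⟩))
      (by simp; omega) ?_
    rintro (j | j | j)
    · simp [adj_a_a hm, Fin.ext_iff]; omega
    · simp [adj_a_b, Fin.ext_iff]; omega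
    · simp [SimpleGraph.adj_comm _ (Sum.inl i), adj_c_a, Fin.ext_iff]; omega

/-- The automorphism of `JGraph m` exchanging the two cycles. -/
def swapIso (hm : 3 ≤ m) : JGraph m ≃g JGraph m where
  toFun := Sum.elim (fun i => Sum.inr (Sum.inl i))
    (Sum.elim (fun i => Sum.inl i) (fun i => Sum.inr (Sum.inr i)))
  invFun := Sum.elim (fun i => Sum.inr (Sum.inl i))
    (Sum.elim (fun i => Sum.inl i) (fun i => Sum.inr (Sum.inr i)))
  left_inv := by rintro (i | i | i) <;> rfl
  right_inv := by rintro (i | i | i) <;> rfl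
  map_rel_iff' := by
    rintro (i | i | i) (j | j | j)
    · simp [adj_a_a hm, adj_b_b hm]
    · simp [SimpleGraph.adj_comm _ (Sum.inr (Sum.inl i)), adj_a_b]; omega
    · simp [SimpleGraph.adj_comm _ _ (Sum.inr (Sum.inr j)), adj_c_a, adj_c_b]
    · simp [SimpleGraph.adj_comm _ (Sum.inr (Sum.inl i)), adj_a_b]; omega
    · simp [adj_a_a hm, adj_b_b hm]
    · simp [SimpleGraph.adj_comm _ _ (Sum.inr (Sum.inr j)), adj_c_a, adj_c_b]
    · simp [adj_c_a, adj_c_b]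
    · simp [adj_c_a, adj_c_b]
    · simp [not_adj_c_c]

lemma degree_eq (hm : 3 ≤ m) (v : JVert m) : (JGraph m).degree v = 4 := by
  rcases v with i | i | i
  · exact degree_a hm i
  · exact ((swapIso hm).degree_eq (Sum.inl i)).trans (degree_a hm i)
  · exact degree_c i

end Degree

section Claw

lemma exists_claw {m : ℕ} (hm : 4 ≤ m) : ∃ v x y z : JVert m,
    (JGraph m).Adj v x ∧ (JGraph m).Adj v y ∧ (JGraph m).Adj v z ∧
      x ≠ y ∧ x ≠ z ∧ y ≠ z ∧
      ¬ (JGraph m).Adj x y ∧ ¬ (JGraph m).Adj x z ∧ ¬ (JGraph m).Adj y z := by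
  refine ⟨Sum.inl ⟨0, by omega⟩, Sum.inl ⟨1, by omega⟩, Sum.inl ⟨m - 1, by omega⟩,
    Sum.inr (Sum.inl ⟨0, by omega⟩), ?_⟩
  simp [adj_a_a (show 3 ≤ m by omega), adj_a_b]
  omega

end Claw

section Labelling

/-! A ladder labelled by `fa i`, `fb i` on the rails and `fc i` on the rungs between positions
`i` and `i + 1`; the label `none` marks a deleted vertex. -/

variable {κ : Type*}

/-- Two labels agree whenever neither of them is `none`. -/
def Compatible (x y : Option κ) : Prop :=
  ∀ u v, x = some u → y = some v → u = v

/-- The labels `fa`, `fb`, `fc` agree on surviving adjacent vertices of the ladder. -/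
structure IsLadderLabelling (fa fb fc : ℕ → Option κ) (n : ℕ) : Prop where
  a_a : ∀ i < n, Compatible (fa i) (fa (i + 1))
  b_b : ∀ i < n, Compatible (fb i) (fb (i + 1))
  c_a : ∀ i < n, Compatible (fc i) (fa i)
  c_a_succ : ∀ i < n, Compatible (fc i) (fa (i + 1))
  c_b : ∀ i < n, Compatible (fc i) (fb i)
  c_b_succ : ∀ i < n, Compatible (fc i) (fb (i + 1))

lemma IsLadderLabelling.swap {fa fb fc : ℕ → Option κ} {n : ℕ}
    (h : IsLadderLabelling fa fb fc n) : IsLadderLabelling fb fa fc n :=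
  ⟨h.b_b, h.a_a, h.c_b, h.c_b_succ, h.c_a, h.c_a_succ⟩

lemma IsLadderLabelling.of_succ {fa fb fc : ℕ → Option κ} {n : ℕ}
    (h : IsLadderLabelling fa fb fc (n + 1)) : IsLadderLabelling fa fb fc n :=
  ⟨fun i hi => h.a_a i (by omega), fun i hi => h.b_b i (by omega),
    fun i hi => h.c_a i (by omega), fun i hi => h.c_a_succ i (by omega),
    fun i hi => h.c_b i (by omega), fun i hi => h.c_b_succ i (by omega)⟩

/-- `1` for a deleted vertex, `0` for a surviving one. -/
def deleted : Option κ → ℕ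
  | none => 1
  | some _ => 0

/-- The number of deleted vertices of the ladder up to position `n`. -/
def deletedCount (fa fb fc : ℕ → Option κ) (n : ℕ) : ℕ :=
  ∑ i ∈ Finset.range (n + 1), deleted (fa i) + ∑ i ∈ Finset.range (n + 1), deleted (fb i) +
    ∑ i ∈ Finset.range n, deleted (fc i)

lemma deletedCount_succ (fa fb fc : ℕ → Option κ) (n : ℕ) :
    deletedCount fa fb fc (n + 1) =
      deletedCount fa fb fc n + deleted (fc n) + deleted (fa (n + 1)) + deleted (fb (n + 1)) := by
  simp only [deletedCount, Finset.sum_range_succ]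
  omega

lemma deletedCount_swap (fa fb fc : ℕ → Option κ) (n : ℕ) :
    deletedCount fa fb fc n = deletedCount fb fa fc n := by
  simp only [deletedCount]
  omega

variable [DecidableEq κ]

/-- The labels occurring on the ladder up to position `n`. -/
def labels (fa fb fc : ℕ → Option κ) : ℕ → Finset κ
  | 0 => (fa 0).toFinset ∪ (fb 0).toFinset
  | n + 1 => labels fa fb fc n ∪ (fc n).toFinset ∪ (fa (n + 1)).toFinset ∪ (fb (n + 1)).toFinset

lemma mem_labels {fa fb fc : ℕ → Option κ} {n : ℕ} {u : κ} :
    u ∈ labels fa fb fc n ↔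
      (∃ i ≤ n, fa i = some u) ∨ (∃ i ≤ n, fb i = some u) ∨ ∃ i < n, fc i = some u := by
  induction n with
  | zero => simp [labels]
  | succ n ih =>
    simp only [labels, Finset.mem_union, ih, Option.mem_toFinset, Option.mem_def,
      Nat.le_succ_iff, Nat.lt_succ_iff_lt_or_eq]
    grind

lemma labels_swap (fa fb fc : ℕ → Option κ) (n : ℕ) :
    labels fa fb fc n = labels fb fa fc n := by
  ext u
  rw [mem_labels, mem_labels, or_left_comm]

/-- The bound carried along the ladder when no label is distinguished. -/
def FreeBound (n : ℕ) (x y : Option κ) (k s : ℕ) : Prop :=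
  match x, y with
  | none, none => 2 * k + 1 ≤ s
  | none, some _ => 2 * k + n % 2 ≤ s + 1
  | some _, none => 2 * k ≤ s + n % 2
  | some u, some v => (u = v → 2 * k ≤ s + 1) ∧ 2 * k ≤ s + 2

lemma freeBound {fa fb fc : ℕ → Option κ} {n : ℕ} (h : IsLadderLabelling fa fb fc n)
    (h0 : fa 0 = none) :
    FreeBound n (fa n) (fb n) (labels fa fb fc n).card (deletedCount fa fb fc n) := by
  induction n with
  | zero =>
    rw [h0]
    cases hb : fb 0 <;> simp [FreeBound, labels, deletedCount, h0, hb, deleted]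
  | succ n ih =>
    replace ih := ih h.of_succ
    have haa := h.a_a n n.lt_succ_self
    have hbb := h.b_b n n.lt_succ_self
    have hca := h.c_a n n.lt_succ_self
    have hcb := h.c_b n n.lt_succ_self
    have hca' := h.c_a_succ n n.lt_succ_self
    have hcb' := h.c_b_succ n n.lt_succ_self
    have hma : ∀ u, fa n = some u → u ∈ labels fa fb fc n :=
      fun u hu => mem_labels.2 (Or.inl ⟨n, le_rfl, hu⟩)
    have hmb : ∀ u, fb n = some u → u ∈ labels fa fb fc n :=
      fun u hu => mem_labels.2 (Or.inr (Or.inl ⟨n, le_rfl, hu⟩))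
    rw [deletedCount_succ, labels]
    generalize labels fa fb fc n = K at *
    generalize deletedCount fa fb fc n = s at *
    generalize fa n = x at *
    generalize fb n = y at *
    generalize fc n = z at *
    generalize fa (n + 1) = x' at *
    generalize fb (n + 1) = y' at *
    clear h h0
    have hK : ∀ (L : Finset κ) u, (L ∪ {u}).card ≤ L.card + 1 := fun L u => by
      simpa using Finset.card_union_le L {u}
    have hK' : ∀ (L : Finset κ) u, u ∈ L → L ∪ {u} = L := fun L u hu => by simpa using hu
    rcases x with _ | x <;> rcases y with _ | y <;> rcases z with _ | z <;>
      rcases x' with _ | x' <;> rcases y' with _ | y' <;>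
      simp [FreeBound, deleted, Compatible] at * <;> grind

/-- The bound carried along the ladder when the label `r` is not counted. -/
def RootedBound (r : κ) (x y : Option κ) (k s : ℕ) : Prop :=
  match x, y with
  | none, none => 2 * k + 2 ≤ s
  | none, some v => (v = r → 1 ≤ s ∧ (0 < k → 2 * k + 2 ≤ s)) ∧ (v ≠ r → 2 * k + 1 ≤ s)
  | some u, none => (u = r → 1 ≤ s ∧ (0 < k → 2 * k + 2 ≤ s)) ∧ (u ≠ r → 2 * k + 1 ≤ s)
  | some u, some v => (u = r → v = r → 0 < k → 2 * k + 2 ≤ s) ∧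
      (u = r ∨ v = r ∨ u = v → 2 * k ≤ s) ∧ 2 * k ≤ s + 1

lemma rootedBound {fa fb fc : ℕ → Option κ} {n : ℕ} (h : IsLadderLabelling fa fb fc n) {r : κ}
    (ha : Compatible (fa 0) (some r)) (hb : Compatible (fb 0) (some r)) :
    RootedBound r (fa n) (fb n) ((labels fa fb fc n).erase r).card (deletedCount fa fb fc n) := by
  induction n with
  | zero =>
    simp only [labels, deletedCount, Finset.range_zero, Finset.sum_empty, zero_add,
      Finset.sum_range_one]
    generalize fa 0 = x at *
    generalize fb 0 = y at *
    cases x <;> cases y <;> simp [RootedBound, deleted, Compatible] at * <;> simp [*]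
  | succ n ih =>
    replace ih := ih h.of_succ
    have haa := h.a_a n n.lt_succ_self
    have hbb := h.b_b n n.lt_succ_self
    have hca := h.c_a n n.lt_succ_self
    have hcb := h.c_b n n.lt_succ_self
    have hca' := h.c_a_succ n n.lt_succ_self
    have hcb' := h.c_b_succ n n.lt_succ_self
    have hma : ∀ u, fa n = some u → u ∈ labels fa fb fc n :=
      fun u hu => mem_labels.2 (Or.inl ⟨n, le_rfl, hu⟩)
    have hmb : ∀ u, fb n = some u → u ∈ labels fa fb fc n :=
      fun u hu => mem_labels.2 (Or.inr (Or.inl ⟨n, le_rfl, hu⟩))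
    rw [deletedCount_succ, labels]
    generalize labels fa fb fc n = K at *
    generalize deletedCount fa fb fc n = s at *
    generalize fa n = x at *
    generalize fb n = y at *
    generalize fc n = z at *
    generalize fa (n + 1) = x' at *
    generalize fb (n + 1) = y' at *
    clear h ha hb
    obtain ⟨c, hc⟩ : ∃ c : Finset κ → ℕ, ∀ L, (L.erase r).card = c L := ⟨_, fun _ => rfl⟩
    have hcr : ∀ u (L : Finset κ), u = r → c (insert u L) = c L := fun u L hu => by
      rw [← hc, ← hc, hu, Finset.erase_insert_eq_erase]
    have hcu : ∀ u (L : Finset κ), c (insert u L) ≤ c L + 1 := fun u L => by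
      rcases eq_or_ne u r with hu | hu
      · rw [hcr u L hu]; omega
      · rw [← hc, ← hc, Finset.erase_insert_of_ne hu]
        exact Finset.card_insert_le _ _
    rw [hc] at ih ⊢
    clear hc
    rcases x with _ | x <;> rcases y with _ | y <;> rcases z with _ | z <;>
      rcases x' with _ | x' <;> rcases y' with _ | y' <;>
      simp [RootedBound, deleted, Compatible] at * <;> grind +splitImp

/-- The bound for a ladder whose corners `fa 0`, `fb 0`, `fb n`, `fa n` are joined in a cycle. -/
lemma two_mul_card_labels_le {fa fb fc : ℕ → Option κ} {n : ℕ} (hn : Even n)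
    (h : IsLadderLabelling fa fb fc n) (haa : Compatible (fa 0) (fa n))
    (hbb : Compatible (fb 0) (fb n)) (hab : Compatible (fa 0) (fb 0))
    (habn : Compatible (fa n) (fb n)) (hk : 1 < (labels fa fb fc n).card) :
    2 * (labels fa fb fc n).card ≤ deletedCount fa fb fc n := by
  have hn := Nat.even_iff.1 hn
  have free : ∀ {f g : ℕ → Option κ}, IsLadderLabelling f g fc n → f 0 = none → g n = none →
      2 * (labels f g fc n).card ≤ deletedCount f g fc n := by
    intro f g h h0 h1
    have := freeBound h h0
    rw [h1] at this
    cases hf : f n <;> simp [FreeBound, hf] at this <;> omega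
  by_cases h1 : fa 0 = none ∧ fb n = none
  · exact free h h1.1 h1.2
  by_cases h2 : fb 0 = none ∧ fa n = none
  · rw [labels_swap, deletedCount_swap]
    exact free h.swap h2.1 h2.2
  obtain ⟨r, hr, hcard⟩ : ∃ r ∈ labels fa fb fc n, Compatible (fa 0) (some r) ∧
      Compatible (fb 0) (some r) ∧ Compatible (fa n) (some r) ∧ Compatible (fb n) (some r) := by
    have ha0 : ∀ u, fa 0 = some u → u ∈ labels fa fb fc n :=
      fun u hu => mem_labels.2 (Or.inl ⟨0, n.zero_le, hu⟩)
    have hbn : ∀ u, fb n = some u → u ∈ labels fa fb fc n :=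
      fun u hu => mem_labels.2 (Or.inr (Or.inl ⟨n, le_rfl, hu⟩))
    clear free h hk
    generalize fa 0 = x₀ at *
    generalize fb 0 = y₀ at *
    generalize fa n = x at *
    generalize fb n = y at *
    rcases x₀ with _ | u
    · rcases y with _ | v
      · exact absurd ⟨rfl, rfl⟩ h1
      · refine ⟨v, hbn v rfl, ?_⟩
        cases y₀ <;> cases x <;> simp_all [Compatible]
    · refine ⟨u, ha0 u rfl, ?_⟩
      cases y₀ <;> cases x <;> cases y <;> simp_all [Compatible]
  have key := rootedBound h hcard.1 hcard.2.1
  have hcard' := Finset.card_erase_add_one hr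
  obtain ⟨-, -, hx, hy⟩ := hcard
  generalize ((labels fa fb fc n).erase r).card = k at *
  rcases hfa : fa n with _ | x <;> rcases hfb : fb n with _ | y <;>
    simp [RootedBound, Compatible, hfa, hfb] at key hx hy <;> grind

end Labelling

section Toughness

variable {m : ℕ}

/-- The component of `JGraph m - S` containing `v`, or `none` if `v` is deleted. -/
noncomputable def component (S : Finset (JVert m)) (v : JVert m) :
    Option ((JGraph m).induce (↑S : Set (JVert m))ᶜ).ConnectedComponent :=
  if h : v ∈ S then none else some (SimpleGraph.connectedComponentMk _ ⟨v, by simpa using h⟩)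

lemma deleted_component (S : Finset (JVert m)) (v : JVert m) :
    deleted (component S v) = if v ∈ S then 1 else 0 := by
  unfold component
  split_ifs <;> rfl

lemma compatible_component (S : Finset (JVert m)) {v w : JVert m} (h : (JGraph m).Adj v w) :
    Compatible (component S v) (component S w) := by
  intro u u' hu hu'
  unfold component at hu hu'
  split_ifs at hu hu'
  rw [← Option.some.inj hu, ← Option.some.inj hu']
  exact SimpleGraph.ConnectedComponent.sound (SimpleGraph.Adj.reachable (by simpa using h))

/-- Extends a function on `Fin k` by `none`. -/
def extend {κ : Type*} {k : ℕ} (f : Fin k → Option κ) (i : ℕ) : Option κ :=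
  if h : i < k then f ⟨i, h⟩ else none

lemma extend_of_lt {κ : Type*} {k : ℕ} (f : Fin k → Option κ) {i : ℕ} (h : i < k) :
    extend f i = f ⟨i, h⟩ :=
  dif_pos h

lemma sum_deleted_extend {κ : Type*} {k : ℕ} (f : Fin k → Option κ) :
    ∑ i ∈ Finset.range k, deleted (extend f i) = ∑ i, deleted (f i) := by
  rw [Finset.sum_range]
  exact Finset.sum_congr rfl fun i _ => by rw [extend_of_lt f i.2]

lemma two_mul_card_component_le (hm : 3 ≤ m) (hodd : Odd m) (S : Finset (JVert m))
    (hS : IsCutset (JGraph m) ↑S) :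
    2 * Nat.card ((JGraph m).induce (↑S : Set (JVert m))ᶜ).ConnectedComponent ≤ S.card := by
  classical
  obtain ⟨n, rfl⟩ : ∃ n, m = n + 1 := ⟨m - 1, by omega⟩
  have hn : Even n := by grind
  set fa := extend fun i => component S (Sum.inl i) with hfa
  set fb := extend fun i => component S (Sum.inr (Sum.inl i)) with hfb
  set fc := extend fun i => component S (Sum.inr (Sum.inr i))
  have ea : ∀ i (hi : i < n + 1), fa i = component S (Sum.inl ⟨i, hi⟩) :=
    fun i hi => extend_of_lt _ hi
  have eb : ∀ i (hi : i < n + 1), fb i = component S (Sum.inr (Sum.inl ⟨i, hi⟩)) :=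
    fun i hi => extend_of_lt _ hi
  have ec : ∀ i (hi : i < n), fc i = component S (Sum.inr (Sum.inr ⟨i, hi⟩)) :=
    fun i hi => extend_of_lt _ hi
  have hlabels : ∀ u, u ∈ labels fa fb fc n := by
    refine SimpleGraph.ConnectedComponent.ind ?_
    rintro ⟨v, hv⟩
    have hv' : component S v = some (SimpleGraph.connectedComponentMk _ ⟨v, hv⟩) :=
      dif_neg (by simpa using hv)
    rw [mem_labels]
    rcases v with i | i | i
    · exact Or.inl ⟨i, by omega, (ea i i.2).trans hv'⟩
    · exact Or.inr (Or.inl ⟨i, by omega, (eb i i.2).trans hv'⟩)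
    · exact Or.inr (Or.inr ⟨i, i.2, (ec i i.2).trans hv'⟩)
  have hcard : Nat.card ((JGraph (n + 1)).induce (↑S : Set (JVert (n + 1)))ᶜ).ConnectedComponent =
      (labels fa fb fc n).card := by
    rw [← Nat.card_congr (Equiv.subtypeUnivEquiv hlabels), Nat.card_eq_fintype_card,
      Fintype.card_coe]
  have hdeleted : deletedCount fa fb fc n = S.card := by
    have hc : ∑ i ∈ Finset.range n, deleted (fc i) = _ := sum_deleted_extend _
    rw [deletedCount, hfa, hfb, sum_deleted_extend, sum_deleted_extend, hc]
    simp only [deleted_component]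
    have hsum : S.card = ∑ v, if v ∈ S then 1 else 0 := by simp
    rw [hsum, Fintype.sum_sum_type, Fintype.sum_sum_type, add_assoc]
    rfl
  have hone : 1 < (labels fa fb fc n).card := by
    have : Nonempty ↥((↑S : Set (JVert (n + 1)))ᶜ) := hS.1.nonempty.to_subtype
    have hconn : ¬ ((JGraph (n + 1)).induce (↑S : Set (JVert (n + 1)))ᶜ).Preconnected :=
      fun h => hS.2 ⟨h⟩
    simp only [SimpleGraph.Preconnected, not_forall] at hconn
    obtain ⟨v, w, hvw⟩ := hconn
    exact Finset.one_lt_card.2 ⟨_, hlabels _, _, hlabels _,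
      fun h => hvw (SimpleGraph.ConnectedComponent.exact h)⟩
  rw [hcard, ← hdeleted]
  refine two_mul_card_labels_le hn ⟨?_, ?_, ?_, ?_, ?_, ?_⟩ ?_ ?_ ?_ ?_ hone
  · intro i hi
    rw [ea i (by omega), ea (i + 1) (by omega)]
    exact compatible_component S ((adj_a_a hm _ _).2 (by simp))
  · intro i hi
    rw [eb i (by omega), eb (i + 1) (by omega)]
    exact compatible_component S ((adj_b_b hm _ _).2 (by simp))
  · intro i hi
    rw [ec i hi, ea i (by omega)]
    exact compatible_component S ((adj_c_a _ _).2 (by simp))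
  · intro i hi
    rw [ec i hi, ea (i + 1) (by omega)]
    exact compatible_component S ((adj_c_a _ _).2 (by simp))
  · intro i hi
    rw [ec i hi, eb i (by omega)]
    exact compatible_component S ((adj_c_b _ _).2 (by simp))
  · intro i hi
    rw [ec i hi, eb (i + 1) (by omega)]
    exact compatible_component S ((adj_c_b _ _).2 (by simp))
  · rw [ea 0 (by omega), ea n (by omega)]
    exact compatible_component S ((adj_a_a hm _ _).2 (by simp))
  · rw [eb 0 (by omega), eb n (by omega)]
    exact compatible_component S ((adj_b_b hm _ _).2 (by simp))
  · rw [ea 0 (by omega), eb 0 (by omega)]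
    exact compatible_component S ((adj_a_b _ _).2 (by simp))
  · rw [ea n (by omega), eb n (by omega)]
    exact compatible_component S ((adj_a_b _ _).2 (by simp))

end Toughness

end JGraph

/-- For every odd `m ≥ 5`, `J_m` is a 4-regular graph on `3m - 1` vertices
that is 2-tough and contains a claw. -/
theorem stmt_12 (m : ℕ) (hm : 5 ≤ m) (hodd : Odd m) :
    Fintype.card (JVert m) = 3 * m - 1 ∧
    (∀ v : JVert m, (JGraph m).degree v = 4) ∧
    (∀ S : Finset (JVert m), IsCutset (JGraph m) ↑S →
      2 * Nat.card ((JGraph m).induce (↑S : Set (JVert m))ᶜ).ConnectedComponent ≤ S.card) ∧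
    (∃ v x y z : JVert m,
      (JGraph m).Adj v x ∧ (JGraph m).Adj v y ∧ (JGraph m).Adj v z ∧
      x ≠ y ∧ x ≠ z ∧ y ≠ z ∧
      ¬ (JGraph m).Adj x y ∧ ¬ (JGraph m).Adj x z ∧ ¬ (JGraph m).Adj y z) := by
  refine ⟨?_, JGraph.degree_eq (by omega),
    JGraph.two_mul_card_component_le (by omega) hodd, JGraph.exists_claw (by omega)⟩
  simp only [Fintype.card_sum, Fintype.card_fin]
  omega
end
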